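/- (Theorem 3.4, Clarke stationarity of the limit point.) For f : ℝⁿ → ℝ Lipschitz continuous on a neighborhood of x ∈ ℝⁿ, define the Clarke generalized directional derivative f°(x; d) = limsup_{y → x, t ↓ 0} ( f(y + t d) − f(y) ) / t. Let x_* ∈ ℝⁿ and suppose f is Lipschitz continuous on an open ball centered at x_*. Let K be an infinite set of indices, (x_k)_{k ∈ K} a sequence with x_k → x_* along K, and (α_k)_{k ∈ K} positive reals with α_k → 0 along K. Let ρ : ℝ → ℝ be positive and non-decreasing on (0,∞) with ρ(α)/α → 0 as α → 0⁺. For each k ∈ K let D_k be a finite nonempty set of unit vectors such that f(x_k + α_k d) > f(x_k) − ρ(α_k) for every d ∈ D_k (unsuccessful poll steps). Assume the density condition: for every unit vector v ∈ ℝⁿ there exist an infinite subset L ⊆ K and a choice d_k ∈ D_k for each k ∈ L with d_k → v along L. Then f°(x_*; d) ≥ 0 for every d ∈ ℝⁿ, i.e. x_* is a Clarke stationary point of f. -/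

import Mathlib

open Filter Topology

/-- The Clarke generalized directional derivative of `f` at `x` along `d`:
`f°(x; d) = limsup_{y → x, t ↓ 0} (f(y + t d) − f(y)) / t`. -/
noncomputable def clarkeDeriv {n : ℕ} (f : EuclideanSpace ℝ (Fin n) → ℝ)
    (x d : EuclideanSpace ℝ (Fin n)) : ℝ :=
  limsup (fun p : EuclideanSpace ℝ (Fin n) × ℝ => (f (p.1 + p.2 • d) - f p.1) / p.2)
    ((𝓝 x) ×ˢ (𝓝[>] (0 : ℝ)))

/-- **Theorem 3.4.** Clarke stationarity of the limit point of a
subsequence of unsuccessful poll steps whose normalized poll directions are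
dense in the unit sphere. -/
theorem clarke_stationary_of_refining_directions {n : ℕ}
    (f : EuclideanSpace ℝ (Fin n) → ℝ)
    (xstar : EuclideanSpace ℝ (Fin n)) (r : ℝ) (hr : 0 < r) (Lstar : ℝ)
    (hlip : ∀ y ∈ Metric.ball xstar r, ∀ z ∈ Metric.ball xstar r,
      |f y - f z| ≤ Lstar * ‖y - z‖)
    (K : Set ℕ) (hK : K.Infinite)
    (x : ℕ → EuclideanSpace ℝ (Fin n))
    (hx : Tendsto x (atTop ⊓ 𝓟 K) (𝓝 xstar))
    (α : ℕ → ℝ) (hαpos : ∀ k, 0 < α k)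
    (hα : Tendsto α (atTop ⊓ 𝓟 K) (𝓝 0))
    (ρ : ℝ → ℝ)
    (hρpos : ∀ a : ℝ, 0 < a → 0 < ρ a)
    (hρmono : ∀ a b : ℝ, 0 < a → a ≤ b → ρ a ≤ ρ b)
    (hρ : Tendsto (fun a => ρ a / a) (𝓝[>] (0 : ℝ)) (𝓝 0))
    (D : ℕ → Finset (EuclideanSpace ℝ (Fin n)))
    (hDne : ∀ k ∈ K, (D k).Nonempty)
    (hDunit : ∀ k ∈ K, ∀ d ∈ D k, ‖d‖ = 1)
    (hpoll : ∀ k ∈ K, ∀ d ∈ D k, f (x k + α k • d) > f (x k) - ρ (α k))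
    (hdense : ∀ v : EuclideanSpace ℝ (Fin n), ‖v‖ = 1 →
      ∃ (L : Set ℕ) (dsel : ℕ → EuclideanSpace ℝ (Fin n)),
        L ⊆ K ∧ L.Infinite ∧ (∀ k ∈ L, dsel k ∈ D k) ∧
        Tendsto dsel (atTop ⊓ 𝓟 L) (𝓝 v)) :
    ∀ d : EuclideanSpace ℝ (Fin n), 0 ≤ clarkeDeriv f xstar d := by
  intro d
  unfold clarkeDeriv
  rw [limsup_eq]
  apply Real.sInf_nonneg
  intro a ha
  simp only [Set.mem_setOf_eq] at ha
  by_cases hd : d = 0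
  · subst hd
    obtain ⟨p, hp⟩ := ha.exists
    simpa using hp
  have hd0 : 0 < ‖d‖ := norm_pos_iff.mpr hd
  obtain ⟨L, e, hLK, hLinf, heD, he⟩ := hdense (‖d‖⁻¹ • d) (by
    rw [norm_smul, norm_inv, norm_norm, inv_mul_cancel₀ hd0.ne'])
  set v := ‖d‖⁻¹ • d with hv
  have hdv : d = ‖d‖ • v := by rw [hv, smul_smul, mul_inv_cancel₀ hd0.ne', one_smul]
  have hle : atTop ⊓ 𝓟 L ≤ atTop ⊓ 𝓟 K := inf_le_inf_left _ (principal_mono.mpr hLK)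
  have hne : (atTop ⊓ 𝓟 L).NeBot := by
    rw [← frequently_mem_iff_neBot]
    exact Nat.frequently_atTop_iff_infinite.mpr hLinf
  have hxL := hx.mono_left hle
  have hαL := hα.mono_left hle
  have hαL' : Tendsto α (atTop ⊓ 𝓟 L) (𝓝[>] 0) :=
    tendsto_nhdsWithin_iff.mpr ⟨hαL, Eventually.of_forall hαpos⟩
  have ht : Tendsto (fun k => α k / ‖d‖) (atTop ⊓ 𝓟 L) (𝓝[>] 0) := by
    refine tendsto_nhdsWithin_iff.mpr ⟨?_, Eventually.of_forall fun k => div_pos (hαpos k) hd0⟩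
    simpa using hαL.div_const ‖d‖
  have hev := (hxL.prodMk ht).eventually ha
  have hlow : Tendsto (fun k => ‖d‖ * (-(ρ (α k) / α k) - Lstar * ‖e k - v‖))
      (atTop ⊓ 𝓟 L) (𝓝 0) := by
    have h1 := hρ.comp hαL'
    have h2 : Tendsto (fun k => ‖e k - v‖) (atTop ⊓ 𝓟 L) (𝓝 0) := by
      simpa using (he.sub_const v).norm
    simpa using (h1.neg.sub (h2.const_mul Lstar)).const_mul ‖d‖
  have hb1 : ∀ᶠ k in atTop ⊓ 𝓟 L, x k + α k • e k ∈ Metric.ball xstar r := by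
    have : Tendsto (fun k => x k + α k • e k) (atTop ⊓ 𝓟 L) (𝓝 xstar) := by
      simpa using hxL.add (hαL.smul he)
    exact this.eventually (Metric.ball_mem_nhds _ hr)
  have hb2 : ∀ᶠ k in atTop ⊓ 𝓟 L, x k + α k • v ∈ Metric.ball xstar r := by
    have : Tendsto (fun k => x k + α k • v) (atTop ⊓ 𝓟 L) (𝓝 xstar) := by
      simpa using hxL.add (hαL.smul_const v)
    exact this.eventually (Metric.ball_mem_nhds _ hr)
  have hmem : ∀ᶠ k in atTop ⊓ 𝓟 L, k ∈ L := mem_inf_of_right (mem_principal_self L)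
  refine le_of_tendsto hlow ?_
  filter_upwards [hev, hb1, hb2, hmem] with k hk h1 h2 hkL
  refine le_trans ?_ hk
  have ha0 := hαpos k
  have hp := hpoll k (hLK hkL) (e k) (heD k hkL)
  have hl := (abs_le.mp (hlip _ h1 _ h2)).2
  have hn : ‖x k + α k • e k - (x k + α k • v)‖ = α k * ‖e k - v‖ := by
    rw [add_sub_add_left_eq_sub, ← smul_sub, norm_smul, Real.norm_eq_abs, abs_of_pos ha0]
  rw [hn] at hl
  have hs : (α k / ‖d‖) • d = α k • v := by rw [hv, smul_smul, div_eq_mul_inv]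
  simp only [hs]
  rw [div_div_eq_mul_div, le_div_iff₀ ha0]
  have : ‖d‖ * (-(ρ (α k) / α k) - Lstar * ‖e k - v‖) * α k
      = (-ρ (α k) - Lstar * (α k * ‖e k - v‖)) * ‖d‖ := by
    field_simp
  rw [this]
  exact mul_le_mul_of_nonneg_right (by linarith) hd0.le
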